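/- arXiv:2301.08701 — 2 statements merged into one kernel-verified Lean document; each statement's English description precedes it below -/
import Mathlib

section
/- For every prime power n = p^r (p prime, r ≥ 0, so including n = 1), there exists a finite partially ordered set P with exactly b(n)·n points whose automorphism group Aut(P) is isomorphic to the cyclic group ℤ/nℤ. -/
/-- `b` on prime powers: `b 1 = 0`, `b 2 = 1`, `b 3 = b 4 = b 5 = b 7 = 3`,
and `b (p^r) = 2` for every other prime power. -/
def b (q : ℕ) : ℕ :=
  if q = 1 then 0
  else if q = 2 then 1
  else if q = 3 ∨ q = 4 ∨ q = 5 ∨ q = 7 then 3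
  else 2

/-- A strict order on `L × ZMod n` that is invariant under translations and all of whose
automorphisms are translations yields a poset with automorphism group `ZMod n`. -/
theorem exists_poset_of_rigid (L : Type) [Fintype L] [Nonempty L] (n : ℕ) [NeZero n]
    (r : L × ZMod n → L × ZMod n → Prop) [IsStrictOrder _ r]
    (hr : ∀ c x y, r (x.1, x.2 + c) (y.1, y.2 + c) ↔ r x y)
    (hrigid : ∀ f : Equiv.Perm (L × ZMod n), (∀ x y, r (f x) (f y) ↔ r x y) →
      ∃ c, ∀ x, f x = (x.1, x.2 + c)) :
    ∃ (P : Type) (instP : PartialOrder P) (instF : Fintype P),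
      @Fintype.card P instF = Fintype.card L * n ∧
      Nonempty ((@OrderIso P P instP.toLE instP.toLE) ≃* Multiplicative (ZMod n)) := by
  let ord : PartialOrder (L × ZMod n) := partialOrderOfSO r
  refine ⟨L × ZMod n, ord, inferInstance, by simp [ZMod.card], ?_⟩
  have le_def : ∀ x y : L × ZMod n, x ≤ y ↔ x = y ∨ r x y := fun _ _ => Iff.rfl
  let T : Multiplicative (ZMod n) →* ((L × ZMod n) ≃o (L × ZMod n)) :=
    { toFun := fun c =>
        { toEquiv := (Equiv.refl L).prodCongr (Equiv.addRight c.toAdd)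
          map_rel_iff' := by
            intro x y
            have h := hr c.toAdd x y
            simp only [le_def]
            refine or_congr (Equiv.apply_eq_iff_eq _) ?_
            exact h }
      map_one' := by
        ext x <;> simp
      map_mul' := by
        intro c d
        ext x
        · simp
        · simp [add_comm, add_left_comm] }
  have hT : ∀ c x, T c x = (x.1, x.2 + c.toAdd) := fun _ _ => rfl
  refine ⟨(MulEquiv.ofBijective T ⟨?_, ?_⟩).symm⟩
  · intro c d h
    obtain ⟨l⟩ := ‹Nonempty L›
    have := congrArg (fun f : (L × ZMod n) ≃o (L × ZMod n) => (f (l, 0)).2) h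
    simpa [hT] using this
  · intro f
    obtain ⟨c, hc⟩ := hrigid f.toEquiv (fun x y => f.lt_iff_lt (x := x) (y := y))
    refine ⟨Multiplicative.ofAdd c, ?_⟩
    exact RelIso.ext fun x => (hc x).symm

/-- The strict order on three copies of `ZMod n` in which `(0, i) < (1, i) < (2, i)` and
`(0, i) < (2, i + 1)`. -/
def threeLevelRel (n : ℕ) (x y : Fin 3 × ZMod n) : Prop :=
  (x.1 = 0 ∧ y.1 = 1 ∧ y.2 = x.2) ∨ (x.1 = 1 ∧ y.1 = 2 ∧ y.2 = x.2) ∨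
    (x.1 = 0 ∧ y.1 = 2 ∧ (y.2 = x.2 ∨ y.2 = x.2 + 1))

instance (n : ℕ) : IsStrictOrder _ (threeLevelRel n) where
  irrefl := by
    rintro ⟨a, i⟩
    simp only [threeLevelRel]
    omega
  trans := by
    rintro ⟨a, i⟩ ⟨b, j⟩ ⟨c, k⟩
    simp only [threeLevelRel]
    rintro (⟨h1, h2, h3⟩ | ⟨h1, h2, h3⟩ | ⟨h1, h2, h3⟩) <;>
    rintro (⟨h4, h5, h6⟩ | ⟨h4, h5, h6⟩ | ⟨h4, h5, h6⟩) <;> subst_vars <;> simp_all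

theorem ZMod.eq_add_of_map_add_one {n : ℕ} [NeZero n] {σ : ZMod n → ZMod n} {e : ZMod n}
    (h : ∀ i, σ (i + 1) = σ i + e) (i : ZMod n) : σ i = σ 0 + e * i := by
  have key : ∀ k : ℕ, σ (k : ZMod n) = σ 0 + e * k := by
    intro k
    induction k with
    | zero => simp
    | succ k ih => push_cast; rw [h, ih]; ring
  simpa using key i.val

theorem threeLevelRel_rigid (n : ℕ) [Fact (1 < n)] (f : Equiv.Perm (Fin 3 × ZMod n))
    (hf : ∀ x y, threeLevelRel n (f x) (f y) ↔ threeLevelRel n x y) :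
    ∃ c, ∀ x, f x = (x.1, x.2 + c) := by
  have : NeZero n := ⟨by have := Fact.out (p := 1 < n); omega⟩
  have lower : ∀ x, x.1 ≠ 0 ↔ ∃ y, threeLevelRel n y x := by
    rintro ⟨a, i⟩
    constructor
    · intro h
      refine ⟨(0, i), ?_⟩
      simp only [threeLevelRel] at *
      fin_cases a <;> simp_all
    · rintro ⟨y, h⟩ h0
      simp only [threeLevelRel] at *
      fin_cases a <;> simp_all
  have upper : ∀ x, x.1 ≠ 2 ↔ ∃ y, threeLevelRel n x y := by
    rintro ⟨a, i⟩
    constructor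
    · intro h
      refine ⟨(2, i), ?_⟩
      simp only [threeLevelRel] at *
      fin_cases a <;> simp_all
    · rintro ⟨y, h⟩ h0
      simp only [threeLevelRel] at *
      fin_cases a <;> simp_all
  have l0 : ∀ x, (f x).1 = 0 ↔ x.1 = 0 := by
    intro x
    rw [← not_iff_not, ← Ne, lower, ← Ne, lower, ← f.exists_congr_right]
    simp only [hf]
  have l2 : ∀ x, (f x).1 = 2 ↔ x.1 = 2 := by
    intro x
    rw [← not_iff_not, ← Ne, upper, ← Ne, upper, ← f.exists_congr_right]
    simp only [hf]
  have level : ∀ x, (f x).1 = x.1 := by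
    intro x
    have h0 := l0 x
    have h2 := l2 x
    omega
  have e01 : ∀ i, (f (1, i)).2 = (f (0, i)).2 := by
    intro i
    have := (hf (0, i) (1, i)).2 (by simp [threeLevelRel])
    simpa [threeLevelRel, level] using this
  have e12 : ∀ i, (f (2, i)).2 = (f (1, i)).2 := by
    intro i
    have := (hf (1, i) (2, i)).2 (by simp [threeLevelRel])
    simpa [threeLevelRel, level] using this
  have step : ∀ i, (f (0, i + 1)).2 = (f (0, i)).2 + 1 := by
    intro i
    have := (hf (0, i) (2, i + 1)).2 (by simp [threeLevelRel])
    simp only [threeLevelRel, level, e12, e01] at this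
    rcases this with h | h | ⟨-, -, h | h⟩
    · simp at h
    · simp at h
    · have : f (0, i + 1) = f (0, i) := Prod.ext (by simp [level]) h
      simp at this
    · exact h
  have h := ZMod.eq_add_of_map_add_one (σ := fun i => (f (0, i)).2) step
  simp only [one_mul] at h
  refine ⟨(f (0, 0)).2, ?_⟩
  rintro ⟨a, i⟩
  refine Prod.ext (level _) ?_
  fin_cases a <;> simp [e12, e01, h i, add_comm]

/-- The strict order on two copies of `ZMod n` in which `(false, i) < (true, i + s)` for `s ∈ S`. -/
def twoLevelRel {n : ℕ} (S : Finset (ZMod n)) (x y : Bool × ZMod n) : Prop :=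
  x.1 = false ∧ y.1 = true ∧ y.2 - x.2 ∈ S

instance {n : ℕ} (S : Finset (ZMod n)) : IsStrictOrder _ (twoLevelRel S) where
  irrefl := by
    rintro ⟨a, i⟩
    simp only [twoLevelRel]
    cases a <;> simp
  trans := by
    rintro ⟨a, i⟩ ⟨b, j⟩ ⟨c, k⟩
    simp only [twoLevelRel]
    cases b <;> simp

/-- The number of ways to write `d` as a difference of two elements of `S`. -/
def differenceCount {n : ℕ} (S : Finset (ZMod n)) (d : ZMod n) : ℕ :=
  (S.filter fun s => s - d ∈ S).card

/-- An injective self-map of `ZMod n` moving consecutive elements to consecutive elements is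
a rotation or a reflection. -/
theorem ZMod.rotation_or_reflection {n : ℕ} [NeZero n] (h2 : (2 : ZMod n) ≠ 0)
    {σ : ZMod n → ZMod n} (hσ : Function.Injective σ)
    (h : ∀ i, σ (i + 1) - σ i = 1 ∨ σ (i + 1) - σ i = -1) :
    (∀ i, σ i = σ 0 + i) ∨ (∀ i, σ i = σ 0 - i) := by
  have hne : ∀ i, σ (i + 1 + 1) ≠ σ i := by
    intro i hi
    apply h2
    have := hσ hi
    linear_combination this
  have hconst : ∀ i, σ (i + 1 + 1) - σ (i + 1) = σ (i + 1) - σ i := by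
    intro i
    rcases h i with h1 | h1 <;> rcases h (i + 1) with h3 | h3
    · rw [h1, h3]
    · exact absurd (by linear_combination h1 + h3) (hne i)
    · exact absurd (by linear_combination h1 + h3) (hne i)
    · rw [h1, h3]
  have hstep : ∀ i, σ (i + 1) = σ i + (σ 1 - σ 0) := by
    intro i
    have := ZMod.eq_add_of_map_add_one (σ := fun i => σ (i + 1) - σ i) (e := 0)
      (by simpa using hconst) i
    simp only [zero_mul, add_zero, zero_add] at this
    linear_combination this
  have hlin := ZMod.eq_add_of_map_add_one hstep
  have h0 := h 0
  rw [zero_add] at h0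
  rcases h0 with h0 | h0
  · left
    intro i
    rw [hlin i, h0, one_mul]
  · right
    intro i
    rw [hlin i, h0]
    ring

theorem twoLevelRel_rigid {n : ℕ} [NeZero n] (h2 : (2 : ZMod n) ≠ 0) (S : Finset (ZMod n))
    (hS : S.Nonempty) (C : ℕ → Prop)
    (hC : ∀ d : ZMod n, d ≠ 0 → (C (differenceCount S d) ↔ d = 1 ∨ d = -1))
    (hrefl : ∀ c, ¬ ∀ s, s ∈ S → c - s ∈ S)
    (hstab : ∀ c, (∀ s, s ∈ S → s + c ∈ S) → c = 0)
    (f : Equiv.Perm (Bool × ZMod n))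
    (hf : ∀ x y, twoLevelRel S (f x) (f y) ↔ twoLevelRel S x y) :
    ∃ c, ∀ x, f x = (x.1, x.2 + c) := by
  have lower : ∀ x, x.1 = true ↔ ∃ y, twoLevelRel S y x := by
    rintro ⟨a, i⟩
    obtain ⟨s, hs⟩ := hS
    constructor
    · intro h
      exact ⟨(false, i - s), rfl, h, by simpa using hs⟩
    · rintro ⟨y, -, h, -⟩
      exact h
  have lt : ∀ x, (f x).1 = true ↔ x.1 = true := by
    intro x
    rw [lower, lower, ← f.exists_congr_right]
    simp only [hf]
  have level : ∀ x, (f x).1 = x.1 := by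
    intro x
    have := lt x
    rwa [← Bool.eq_iff_iff] at this
  obtain ⟨σ, hσ⟩ : ∃ σ : ZMod n → ZMod n, ∀ i, f (false, i) = (false, σ i) :=
    ⟨fun i => (f (false, i)).2, fun i => Prod.ext (level _) rfl⟩
  obtain ⟨τ, hτ⟩ : ∃ τ : ZMod n → ZMod n, ∀ i, f (true, i) = (true, τ i) :=
    ⟨fun i => (f (true, i)).2, fun i => Prod.ext (level _) rfl⟩
  have hστ : ∀ i j, τ j - σ i ∈ S ↔ j - i ∈ S := by
    intro i j
    simpa [twoLevelRel, hσ, hτ] using hf (false, i) (true, j)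
  have σinj : Function.Injective σ := by
    intro i j h
    have : f (false, i) = f (false, j) := by rw [hσ, hσ, h]
    simpa using this
  have τinj : Function.Injective τ := by
    intro i j h
    have : f (true, i) = f (true, j) := by rw [hτ, hτ, h]
    simpa using this
  have τsurj : Function.Surjective τ := Finite.surjective_of_injective τinj
  have count : ∀ i k, differenceCount S (k - i) =
      (Finset.univ.filter fun j => j - i ∈ S ∧ j - k ∈ S).card := by
    intro i k
    refine Finset.card_bij (fun s _ => s + i) ?_ ?_ ?_
    · intro s hs
      rw [Finset.mem_filter] at hs ⊢
      refine ⟨Finset.mem_univ _, by simpa using hs.1, ?_⟩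
      convert hs.2 using 1
      ring
    · intro s _ t _ h
      exact add_right_cancel h
    · intro j hj
      rw [Finset.mem_filter] at hj
      refine ⟨j - i, Finset.mem_filter.2 ⟨hj.2.1, ?_⟩, by ring⟩
      convert hj.2.2 using 1
      ring
  have hcount : ∀ i k, differenceCount S (σ k - σ i) = differenceCount S (k - i) := by
    intro i k
    rw [count, count]
    symm
    refine Finset.card_bij (fun j _ => τ j) ?_ (fun j _ j' _ h => τinj h) ?_
    · intro j hj
      simpa [hστ] using hj
    · intro j hj
      obtain ⟨j, rfl⟩ := τsurj j
      exact ⟨j, by simpa [hστ] using hj, rfl⟩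
  have hone : (1 : ZMod n) ≠ 0 := by
    intro h
    exact h2 (by linear_combination 2 * h)
  have hstep : ∀ i, σ (i + 1) - σ i = 1 ∨ σ (i + 1) - σ i = -1 := by
    intro i
    rw [← hC, hcount, add_sub_cancel_left, hC 1 hone]
    · exact Or.inl rfl
    · intro h
      have := σinj (sub_eq_zero.1 h)
      exact hone (by simpa using this)
  rcases ZMod.rotation_or_reflection h2 σinj hstep with h | h
  · have hτ' : ∀ j, τ j = j + σ 0 := by
      intro j
      refine sub_eq_zero.1 (hstab _ fun s hs => ?_)
      have := (hστ (j - s) j).2 (by simpa using hs)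
      rw [h] at this
      convert this using 1
      ring
    refine ⟨σ 0, ?_⟩
    rintro ⟨_ | _, i⟩
    · rw [hσ, h, add_comm]
    · rw [hτ, hτ']
  · refine absurd (fun s hs => ?_) (hrefl (τ 0 - σ 0))
    have := (hστ (-s) 0).2 (by simpa using hs)
    rw [h] at this
    convert this using 1
    ring

theorem exists_poset_of_two_level {n : ℕ} [NeZero n] (h2 : (2 : ZMod n) ≠ 0) (S : Finset (ZMod n))
    (hS : S.Nonempty) (C : ℕ → Prop)
    (hC : ∀ d : ZMod n, d ≠ 0 → (C (differenceCount S d) ↔ d = 1 ∨ d = -1))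
    (hrefl : ∀ c, ¬ ∀ s, s ∈ S → c - s ∈ S)
    (hstab : ∀ c, (∀ s, s ∈ S → s + c ∈ S) → c = 0) :
    ∃ (P : Type) (instP : PartialOrder P) (instF : Fintype P),
      @Fintype.card P instF = 2 * n ∧
      Nonempty ((@OrderIso P P instP.toLE instP.toLE) ≃* Multiplicative (ZMod n)) :=
  exists_poset_of_rigid Bool n (twoLevelRel S) (fun c x y => by simp [twoLevelRel])
    (twoLevelRel_rigid h2 S hS C hC hrefl hstab)

theorem exists_poset_of_three_level (n : ℕ) (hn : 1 < n) :
    ∃ (P : Type) (instP : PartialOrder P) (instF : Fintype P),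
      @Fintype.card P instF = 3 * n ∧
      Nonempty ((@OrderIso P P instP.toLE instP.toLE) ≃* Multiplicative (ZMod n)) := by
  have : Fact (1 < n) := ⟨hn⟩
  have : NeZero n := ⟨by omega⟩
  exact exists_poset_of_rigid (Fin 3) n (threeLevelRel n)
    (fun c x y => by simp [threeLevelRel, add_right_comm _ c 1]) (threeLevelRel_rigid n)

theorem exists_poset_two :
    ∃ (P : Type) (instP : PartialOrder P) (instF : Fintype P),
      @Fintype.card P instF = 1 * 2 ∧
      Nonempty ((@OrderIso P P instP.toLE instP.toLE) ≃* Multiplicative (ZMod 2)) := by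
  have : IsStrictOrder (Unit × ZMod 2) (fun _ _ => False) :=
    { irrefl := fun _ h => h, trans := fun _ _ _ h _ => h }
  refine exists_poset_of_rigid Unit 2 (fun _ _ => False) (by simp) fun f _ => ?_
  have h : f ((), 0) ≠ f ((), 1) := f.injective.ne (by decide)
  generalize hu : f ((), 0) = u at h
  generalize hv : f ((), 1) = v at h
  refine ⟨u.2, ?_⟩
  rintro ⟨⟨⟩, i⟩
  have hi : i = 0 ∨ i = 1 := by revert i; decide
  rcases hi with rfl | rfl
  · rw [hu]
    clear hu hv h
    revert u; decide
  · rw [hv]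
    clear hu hv
    revert u v; decide

theorem ZMod.intCast_eq_of_abs_sub_lt {n : ℕ} {a b : ℤ} (h : (a : ZMod n) = b)
    (hab : |a - b| < n) : a = b := by
  rw [ZMod.intCast_eq_intCast_iff_dvd_sub] at h
  have := Int.eq_zero_of_abs_lt_dvd h (by rwa [abs_sub_comm])
  omega

theorem exists_poset_of_eleven_le (n : ℕ) (hn : 11 ≤ n) :
    ∃ (P : Type) (instP : PartialOrder P) (instF : Fintype P),
      @Fintype.card P instF = 2 * n ∧
      Nonempty ((@OrderIso P P instP.toLE instP.toLE) ≃* Multiplicative (ZMod n)) := by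
  have : NeZero n := ⟨by omega⟩
  have inj : ∀ a b : ℤ, a - b ≤ 10 → b - a ≤ 10 → (a : ZMod n) = b → a = b := by
    intro a b h1 h2 h
    refine ZMod.intCast_eq_of_abs_sub_lt h ?_
    rw [abs_lt]
    omega
  let S : Finset (ZMod n) := {0, 1, 2, 5}
  have memS : ∀ x, x ∈ S ↔ ∃ a : ℤ, x = a ∧ (a = 0 ∨ a = 1 ∨ a = 2 ∨ a = 5) := by
    intro x
    simp only [S, Finset.mem_insert, Finset.mem_singleton]
    constructor
    · rintro (h | h | h | h)
      · exact ⟨0, by simpa using h, by simp⟩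
      · exact ⟨1, by simpa using h, by simp⟩
      · exact ⟨2, by simpa using h, by simp⟩
      · exact ⟨5, by simpa using h, by simp⟩
    · rintro ⟨a, rfl, rfl | rfl | rfl | rfl⟩ <;> simp
  have m0 : (0 : ZMod n) ∈ S := by simp [S]
  have m1 : (1 : ZMod n) ∈ S := by simp [S]
  have m2 : (2 : ZMod n) ∈ S := by simp [S]
  have m5 : (5 : ZMod n) ∈ S := by simp [S]
  have h1 : (1 : ZMod n) ≠ 0 := fun h => by
    have := inj 1 0 (by norm_num) (by norm_num) (by simpa using h)
    omega
  have h2 : (2 : ZMod n) ≠ 0 := fun h => by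
    have := inj 2 0 (by norm_num) (by norm_num) (by simpa using h)
    omega
  refine exists_poset_of_two_level h2 S ⟨0, m0⟩ (1 < ·) ?_ ?_ ?_
  · intro d hd
    rw [differenceCount, Finset.one_lt_card]
    constructor
    · rintro ⟨x, hx, y, hy, hxy⟩
      rw [Finset.mem_filter, memS, memS] at hx hy
      obtain ⟨⟨a, rfl, ha⟩, b, hb, hb'⟩ := hx
      obtain ⟨⟨a', rfl, ha'⟩, b', hd', hb''⟩ := hy
      have hab := inj (a - b) (a' - b') (by omega) (by omega)
        (by push_cast; linear_combination hb - hd')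
      have hne : a ≠ a' := fun h => hxy (by rw [h])
      have hd'' : d = ((a - b : ℤ) : ZMod n) := by push_cast; linear_combination -hb
      have h0 : a - b ≠ 0 := fun h => hd (by rw [hd'', h]; simp)
      have : a - b = 1 ∨ a - b = -1 := by omega
      rcases this with h | h
      · left; rw [hd'', h]; simp
      · right; rw [hd'', h]; simp
    · rintro (rfl | rfl)
      · refine ⟨1, ?_, 2, ?_, ?_⟩
        · rw [Finset.mem_filter]; exact ⟨m1, by simpa using m0⟩
        · rw [Finset.mem_filter]; exact ⟨m2, by convert m1 using 1; ring⟩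
        · exact fun h => h1 (by linear_combination -h)
      · refine ⟨0, ?_, 1, ?_, h1.symm⟩
        · rw [Finset.mem_filter]; exact ⟨m0, by simpa using m1⟩
        · rw [Finset.mem_filter]; exact ⟨m1, by convert m2 using 1; ring⟩
  · intro c h
    obtain ⟨x, hx, hx'⟩ := (memS _).1 (h _ m0)
    obtain ⟨y, hy, hy'⟩ := (memS _).1 (h _ m1)
    obtain ⟨z, hz, hz'⟩ := (memS _).1 (h _ m2)
    obtain ⟨w, hw, hw'⟩ := (memS _).1 (h _ m5)
    have e1 := inj x (y + 1) (by omega) (by omega) (by push_cast; linear_combination hy - hx)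
    have e2 := inj x (z + 2) (by omega) (by omega) (by push_cast; linear_combination hz - hx)
    have e3 := inj x (w + 5) (by omega) (by omega) (by push_cast; linear_combination hw - hx)
    omega
  · intro c h
    obtain ⟨x, hx, hx'⟩ := (memS _).1 (h _ m0)
    obtain ⟨y, hy, hy'⟩ := (memS _).1 (h _ m1)
    obtain ⟨z, hz, hz'⟩ := (memS _).1 (h _ m2)
    have e1 := inj (x + 1) y (by omega) (by omega) (by push_cast; linear_combination hy - hx)
    have e2 := inj (x + 2) z (by omega) (by omega) (by push_cast; linear_combination hz - hx)
    have e3 : x = 0 := by omega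
    rw [e3] at hx
    simpa using hx

theorem exists_poset_eight :
    ∃ (P : Type) (instP : PartialOrder P) (instF : Fintype P),
      @Fintype.card P instF = 2 * 8 ∧
      Nonempty ((@OrderIso P P instP.toLE instP.toLE) ≃* Multiplicative (ZMod 8)) :=
  exists_poset_of_two_level (by decide) {0, 3, 4, 6} (by decide) (· = 1) (by decide) (by decide)
    (by decide)

theorem exists_poset_nine :
    ∃ (P : Type) (instP : PartialOrder P) (instF : Fintype P),
      @Fintype.card P instF = 2 * 9 ∧
      Nonempty ((@OrderIso P P instP.toLE instP.toLE) ≃* Multiplicative (ZMod 9)) :=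
  exists_poset_of_two_level (by decide) {0, 2, 6} (by decide) (· = 0) (by decide) (by decide)
    (by decide)

theorem exists_poset_one :
    ∃ (P : Type) (instP : PartialOrder P) (instF : Fintype P),
      @Fintype.card P instF = 0 * 1 ∧
      Nonempty ((@OrderIso P P instP.toLE instP.toLE) ≃* Multiplicative (ZMod 1)) := by
  refine ⟨Empty, inferInstance, inferInstance, rfl, ⟨?_⟩⟩
  have : Unique (Empty ≃o Empty) := { default := 1, uniq := fun f => by ext x; exact x.elim }
  have : Unique (Multiplicative (ZMod 1)) := inferInstanceAs (Unique (Fin 1))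
  exact MulEquiv.ofUnique

theorem Nat.Prime.pow_ne_of_dvd_of_dvd {p r k l m : ℕ} (hp : p.Prime) (hk : k.Prime)
    (hl : l.Prime) (hkl : k ≠ l) (hkm : k ∣ m) (hlm : l ∣ m) : p ^ r ≠ m := by
  rintro rfl
  have h1 := (Nat.prime_dvd_prime_iff_eq hk hp).1 (hk.dvd_of_dvd_pow hkm)
  have h2 := (Nat.prime_dvd_prime_iff_eq hl hp).1 (hl.dvd_of_dvd_pow hlm)
  exact hkl (h1.trans h2.symm)

/-- For every prime power `n = p ^ r` (including `r = 0`, i.e. `n = 1`) there exists a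
finite poset `P` with exactly `b n * n` points whose automorphism group is isomorphic
to the cyclic group `ℤ/nℤ`. -/
theorem smallest_poset_prime_power (p r : ℕ) (hp : p.Prime) :
    ∃ (P : Type) (instP : PartialOrder P) (instF : Fintype P),
      @Fintype.card P instF = b (p ^ r) * p ^ r ∧
      Nonempty ((@OrderIso P P instP.toLE instP.toLE) ≃* Multiplicative (ZMod (p ^ r))) := by
  have h0 : p ^ r ≠ 0 := pow_ne_zero r hp.ne_zero
  have h6 : p ^ r ≠ 6 := hp.pow_ne_of_dvd_of_dvd Nat.prime_two Nat.prime_three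
    (by norm_num) (by norm_num) (by norm_num)
  have h10 : p ^ r ≠ 10 := hp.pow_ne_of_dvd_of_dvd Nat.prime_two Nat.prime_five
    (by norm_num) (by norm_num) (by norm_num)
  generalize p ^ r = n at *
  rcases Nat.lt_or_ge n 11 with hn | hn
  · interval_cases n
    · exact absurd rfl h0
    · exact exists_poset_one
    · exact exists_poset_two
    · exact exists_poset_of_three_level 3 (by norm_num)
    · exact exists_poset_of_three_level 4 (by norm_num)
    · exact exists_poset_of_three_level 5 (by norm_num)
    · exact absurd rfl h6
    · exact exists_poset_of_three_level 7 (by norm_num)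
    · exact exists_poset_eight
    · exact exists_poset_nine
    · exact absurd rfl h10
  · have hb : b n = 2 := by
      unfold b
      split_ifs <;> omega
    rw [hb]
    exact exists_poset_of_eleven_le n hn
end

section
/- Let n ≥ 1 and let P be a finite poset with Aut(P) cyclic of order n, generated by g. If p^r is a prime power exactly dividing n with p^r ∉ {2, 4}, then Σ_{α ∈ g} w_{p^r}(α) ≥ b(p^r), where the sum ranges over all cycles α of g. -/
/-- A prime power `q = p^r` exactly divides `n` if `q ∣ n` and `p^(r+1) = q * p ∤ n`. -/
def ExactDvd (q n : ℕ) : Prop := q ∣ n ∧ ¬ (q * q.minFac ∣ n)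

/-- The orbit of `x` under the cyclic group generated by the automorphism `g`. -/
def orbit {P : Type} [PartialOrder P] (g : P ≃o P) (x : P) : Set P :=
  {y | ∃ m : ℤ, (g ^ m) x = y}

/-- The cycles of the automorphism `g`: the orbits of `⟨g⟩` of cardinality at least `2`. -/
def cycles {P : Type} [PartialOrder P] (g : P ≃o P) : Set (Set P) :=
  {A | (∃ x : P, A = orbit g x) ∧ 2 ≤ A.ncard}

open scoped Classical

/-- The weight `w_q(α)` of the prime power `q` in a cycle `α` of length `l`, for a
generator of a cyclic automorphism group of order `n`.  Any weight not explicitly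
assigned is `0`.
* Exception 6 (`l = 6`): if `3 ∥ n` then `w₃ = 2`; else if `2 ∥ n` then `w₂ = 3`;
  else `w₄ = 3/2`.
* Exception 12 (`l = 12`): if `3 ∥ n` then `w₃ = 4`; else `w₄ = 3`.
* Exception 10-14 (`l = 2p`, `p = 5, 7`): if `2 ∥ n` then `w₂ = 1`, otherwise
  `w₄ = 1/2`; in either case `w_p = 2(p-1)/p`.
* General case (`l = p₁^{r₁}⋯p_k^{r_k} ∉ {6,10,12,14}`): `w_{p_i^{r_i}} = (l/p_i^{r_i})/k`,
  except that if `p_i^{r_i} = 2` and `2 ∦ n` then `w₂ = 0` and `w₄ = (l/2)/(2k)`. -/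
noncomputable def w (n l q : ℕ) : ℚ :=
  if l = 6 then
    (if ExactDvd 3 n then (if q = 3 then 2 else 0)
     else if ExactDvd 2 n then (if q = 2 then 3 else 0)
     else (if q = 4 then 3/2 else 0))
  else if l = 12 then
    (if ExactDvd 3 n then (if q = 3 then 4 else 0)
     else (if q = 4 then 3 else 0))
  else if l = 10 then
    (if q = 5 then 8/5
     else if ExactDvd 2 n then (if q = 2 then 1 else 0)
     else (if q = 4 then 1/2 else 0))
  else if l = 14 then
    (if q = 7 then 12/7
     else if ExactDvd 2 n then (if q = 2 then 1 else 0)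
     else (if q = 4 then 1/2 else 0))
  else
    if IsPrimePow q ∧ ExactDvd q l ∧ ¬ (q = 2 ∧ ¬ ExactDvd 2 n) then
      ((l : ℚ) / q) / (l.primeFactors.card : ℚ)
    else if q = 4 ∧ ¬ ExactDvd 2 n ∧ ExactDvd 2 l then
      ((l : ℚ) / 2) / (2 * (l.primeFactors.card : ℚ))
    else 0

section Arithmetic

theorem two_pow_card_primeFactors_le {m : ℕ} (hm : m ≠ 0) : 2 ^ m.primeFactors.card ≤ m :=
  calc 2 ^ m.primeFactors.card ≤ ∏ p ∈ m.primeFactors, p :=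
        Finset.pow_card_le_prod _ _ _ fun _ hx => (Nat.prime_of_mem_primeFactors hx).two_le
    _ ≤ m := Nat.le_of_dvd (Nat.pos_of_ne_zero hm) (Nat.prod_primeFactors_dvd m)

theorem card_primeFactors_succ_le {m : ℕ} (hm : m ≠ 0) : m.primeFactors.card + 1 ≤ m :=
  (Nat.lt_two_pow_self).trans_le (two_pow_card_primeFactors_le hm)

theorem three_mul_card_primeFactors_succ_le {m : ℕ} (hm : 3 ≤ m) :
    3 * (m.primeFactors.card + 1) ≤ 2 * m := by
  have h := two_pow_card_primeFactors_le (m := m) (by omega)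
  obtain rfl | h4 := eq_or_ne m 4
  · have : (4 : ℕ).primeFactors.card = 1 := by
      rw [show (4 : ℕ) = 2 ^ 2 by norm_num, Nat.primeFactors_prime_pow two_ne_zero Nat.prime_two]
      simp
    omega
  · have key : ∀ k : ℕ, 3 ≤ k → 3 * (k + 1) ≤ 2 * 2 ^ k := by
      intro k hk
      induction k, hk using Nat.le_induction with
      | base => norm_num
      | succ k hk ih => rw [pow_succ]; omega
    by_cases hk : 3 ≤ m.primeFactors.card
    · have := key _ hk
      omega
    · interval_cases m.primeFactors.card <;> omega

theorem exactDvd_prime_pow {p r n : ℕ} (hp : p.Prime) (hr : r ≠ 0) :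
    ExactDvd (p ^ r) n ↔ p ^ r ∣ n ∧ ¬ p ^ (r + 1) ∣ n := by
  rw [ExactDvd, hp.pow_minFac hr, pow_succ]

theorem ExactDvd.of_dvd {q l n : ℕ} (hq : ExactDvd q n) (hl : l ∣ n) (hql : q ∣ l) :
    ExactDvd q l :=
  ⟨hql, fun h => hq.2 (h.trans hl)⟩

theorem w_nonneg (n l q : ℕ) : 0 ≤ w n l q := by
  unfold w
  split_ifs <;> positivity

variable {p r n l : ℕ}

theorem w_general (hp : p.Prime) (hr : r ≠ 0) (h2 : p ^ r ≠ 2) {m : ℕ}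
    (hl : ExactDvd (p ^ r) (p ^ r * m))
    (h6 : p ^ r * m ≠ 6) (h10 : p ^ r * m ≠ 10) (h12 : p ^ r * m ≠ 12) (h14 : p ^ r * m ≠ 14) :
    w n (p ^ r * m) (p ^ r) = (m : ℚ) / ((m.primeFactors.card + 1 : ℕ) : ℚ) := by
  have hpm : ¬ p ∣ m := fun h =>
    ((exactDvd_prime_pow hp hr).1 hl).2 (by rw [pow_succ]; exact mul_dvd_mul_left _ h)
  have hcop : (p ^ r).Coprime m := ((Nat.Prime.coprime_iff_not_dvd hp).2 hpm).pow_left r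
  have hcard : (p ^ r * m).primeFactors.card = m.primeFactors.card + 1 := by
    rw [hcop.primeFactors_mul, Finset.card_union_of_disjoint hcop.disjoint_primeFactors,
      Nat.primeFactors_prime_pow hr hp, Finset.card_singleton, add_comm]
  have hq0 : ((p ^ r : ℕ) : ℚ) ≠ 0 := by exact_mod_cast (pow_pos hp.pos r).ne'
  rw [w, if_neg h6, if_neg h12, if_neg h10, if_neg h14,
    if_pos ⟨hp.isPrimePow.pow hr, hl, fun h => h2 h.1⟩, hcard, Nat.cast_mul,
    mul_div_cancel_left₀ _ hq0]

theorem prime_pow_dvd_exceptional (hp : p.Prime) (hr : r ≠ 0) (h2 : p ^ r ≠ 2) (h4 : p ^ r ≠ 4)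
    (hdvd : p ^ r ∣ l) (hl : l = 6 ∨ l = 10 ∨ l = 12 ∨ l = 14) :
    p ^ r = 3 ∧ (l = 6 ∨ l = 12) ∨ p ^ r = 5 ∧ l = 10 ∨ p ^ r = 7 ∧ l = 14 := by
  have hpp : IsPrimePow (p ^ r) := hp.isPrimePow.pow hr
  generalize p ^ r = q at *
  have h6 : ¬ IsPrimePow 6 := fun h => by
    have := (isPrimePow_iff_card_primeFactors_eq_one).1 h
    rw [show (6 : ℕ).primeFactors = {2, 3} by decide +kernel] at this
    simp at this
  have h10 : ¬ IsPrimePow 10 := fun h => by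
    have := (isPrimePow_iff_card_primeFactors_eq_one).1 h
    rw [show (10 : ℕ).primeFactors = {2, 5} by decide +kernel] at this
    simp at this
  have h12 : ¬ IsPrimePow 12 := fun h => by
    have := (isPrimePow_iff_card_primeFactors_eq_one).1 h
    rw [show (12 : ℕ).primeFactors = {2, 3} by decide +kernel] at this
    simp at this
  have h14 : ¬ IsPrimePow 14 := fun h => by
    have := (isPrimePow_iff_card_primeFactors_eq_one).1 h
    rw [show (14 : ℕ).primeFactors = {2, 7} by decide +kernel] at this
    simp at this
  have h1 := hpp.one_lt
  have hle : q ≤ l := Nat.le_of_dvd (by omega) hdvd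
  rcases hl with rfl | rfl | rfl | rfl <;> interval_cases q <;> first | omega | contradiction

theorem w_exceptional (hp : p.Prime) (hr : r ≠ 0) (h2 : p ^ r ≠ 2) (h4 : p ^ r ≠ 4)
    (hq : ExactDvd (p ^ r) n) (hdvd : p ^ r ∣ l) (hl : l = 6 ∨ l = 10 ∨ l = 12 ∨ l = 14) :
    3 / 2 ≤ w n l (p ^ r) := by
  obtain ⟨h, rfl | rfl⟩ | ⟨h, rfl⟩ | ⟨h, rfl⟩ := prime_pow_dvd_exceptional hp hr h2 h4 hdvd hl <;>
    rw [h] at hq ⊢ <;> simp [w, hq] <;> norm_num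

theorem one_le_w (hp : p.Prime) (hr : r ≠ 0) (h2 : p ^ r ≠ 2) (h4 : p ^ r ≠ 4)
    (hq : ExactDvd (p ^ r) n) (hl0 : l ≠ 0) (hln : l ∣ n) (hdvd : p ^ r ∣ l) :
    1 ≤ w n l (p ^ r) := by
  by_cases hl : l = 6 ∨ l = 10 ∨ l = 12 ∨ l = 14
  · linarith [w_exceptional hp hr h2 h4 hq hdvd hl]
  have hE := hq.of_dvd hln hdvd
  obtain ⟨m, rfl⟩ := hdvd
  push Not at hl
  have hm : m ≠ 0 := right_ne_zero_of_mul hl0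
  rw [w_general hp hr h2 hE hl.1 hl.2.1 hl.2.2.1 hl.2.2.2, le_div_iff₀ (by positivity), one_mul]
  exact_mod_cast card_primeFactors_succ_le hm

theorem three_halves_le_w (hp : p.Prime) (hr : r ≠ 0) (hq357 : p ^ r = 3 ∨ p ^ r = 5 ∨ p ^ r = 7)
    (hq : ExactDvd (p ^ r) n) (hl0 : l ≠ 0) (hln : l ∣ n) (hdvd : p ^ r ∣ l) (hlq : l ≠ p ^ r) :
    3 / 2 ≤ w n l (p ^ r) := by
  have h2 : p ^ r ≠ 2 := by omega
  have h4 : p ^ r ≠ 4 := by omega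
  by_cases hl : l = 6 ∨ l = 10 ∨ l = 12 ∨ l = 14
  · exact w_exceptional hp hr h2 h4 hq hdvd hl
  have hE := hq.of_dvd hln hdvd
  obtain ⟨m, rfl⟩ := hdvd
  push Not at hl
  have hm : m ≠ 0 := right_ne_zero_of_mul hl0
  have hm3 : 3 ≤ m := by
    by_contra hlt
    have : m = 1 ∨ m = 2 := by omega
    rcases this with rfl | rfl
    · simp at hlq
    · omega
  rw [w_general hp hr h2 hE hl.1 hl.2.1 hl.2.2.1 hl.2.2.2, le_div_iff₀ (by positivity)]
  have : ((3 * (m.primeFactors.card + 1) : ℕ) : ℚ) ≤ ((2 * m : ℕ) : ℚ) :=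
    Nat.cast_le.2 (three_mul_card_primeFactors_succ_le hm3)
  push_cast at this ⊢
  linarith

/-- For `p = 3, 5, 7`, every subset of `ℤ/p` is preserved by an affine map with multiplier
different from `0` and `1`. -/
theorem exists_affine_symmetry (hp : p = 3 ∨ p = 5 ∨ p = 7) (S : ZMod p → Prop) :
    ∃ u c : ZMod p, u ≠ 0 ∧ u ≠ 1 ∧ ∀ s, S s ↔ S (u * s + c) := by
  rcases hp with rfl | rfl | rfl
  · have key : ∀ b0 b1 b2 : Bool, ∃ u c : Fin 3, u ≠ 0 ∧ u ≠ 1 ∧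
        ∀ s, (![b0, b1, b2] : Fin 3 → Bool) s = ![b0, b1, b2] (u * s + c) := by decide +kernel
    obtain ⟨u, c, h0, h1, h⟩ := key (S 0) (S 1) (S 2)
    have e : ∀ s : Fin 3, (![decide (S 0), S 1, S 2] : Fin 3 → Bool) s = decide (S s) := by
      intro s; fin_cases s <;> rfl
    exact ⟨u, c, h0, h1, fun s => decide_eq_decide.1 ((e s).symm.trans ((h s).trans (e _)))⟩
  · have key : ∀ b0 b1 b2 b3 b4 : Bool, ∃ u c : Fin 5, u ≠ 0 ∧ u ≠ 1 ∧
        ∀ s, (![b0, b1, b2, b3, b4] : Fin 5 → Bool) s = ![b0, b1, b2, b3, b4] (u * s + c) := by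
      decide +kernel
    obtain ⟨u, c, h0, h1, h⟩ := key (S 0) (S 1) (S 2) (S 3) (S 4)
    have e : ∀ s : Fin 5,
        (![decide (S 0), S 1, S 2, S 3, S 4] : Fin 5 → Bool) s = decide (S s) := by
      intro s; fin_cases s <;> rfl
    exact ⟨u, c, h0, h1, fun s => decide_eq_decide.1 ((e s).symm.trans ((h s).trans (e _)))⟩
  · have key : ∀ b0 b1 b2 b3 b4 b5 b6 : Bool, ∃ u c : Fin 7, u ≠ 0 ∧ u ≠ 1 ∧
        ∀ s, (![b0, b1, b2, b3, b4, b5, b6] : Fin 7 → Bool) s =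
          ![b0, b1, b2, b3, b4, b5, b6] (u * s + c) := by
      decide +kernel
    obtain ⟨u, c, h0, h1, h⟩ := key (S 0) (S 1) (S 2) (S 3) (S 4) (S 5) (S 6)
    have e : ∀ s : Fin 7,
        (![decide (S 0), S 1, S 2, S 3, S 4, S 5, S 6] : Fin 7 → Bool) s = decide (S s) := by
      intro s; fin_cases s <;> rfl
    exact ⟨u, c, h0, h1, fun s => decide_eq_decide.1 ((e s).symm.trans ((h s).trans (e _)))⟩

end Arithmetic

section Orbits

variable {P : Type} [PartialOrder P] {g : P ≃o P}

theorem mem_orbit_self (g : P ≃o P) (x : P) : x ∈ orbit g x := ⟨0, by simp⟩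

theorem zpow_apply_mem_orbit (m : ℤ) (x : P) : (g ^ m) x ∈ orbit g x := ⟨m, rfl⟩

theorem zpow_add_apply (i j : ℤ) (x : P) : (g ^ (i + j)) x = (g ^ i) ((g ^ j) x) := by
  rw [zpow_add, RelIso.mul_apply]

theorem orbit_eq_of_mem {x y : P} (h : y ∈ orbit g x) : orbit g y = orbit g x := by
  obtain ⟨m, rfl⟩ := h
  ext z
  constructor
  · rintro ⟨k, rfl⟩
    exact ⟨k + m, zpow_add_apply _ _ _⟩
  · rintro ⟨k, rfl⟩
    exact ⟨k - m, by rw [← zpow_add_apply, sub_add_cancel]⟩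

theorem zpow_apply_mem_orbit_iff {x y : P} (m : ℤ) : (g ^ m) y ∈ orbit g x ↔ y ∈ orbit g x := by
  constructor
  · rintro ⟨k, hk⟩
    exact ⟨-m + k, by rw [zpow_add_apply, hk, ← zpow_add_apply, neg_add_cancel, zpow_zero]; rfl⟩
  · rintro ⟨k, rfl⟩
    exact ⟨m + k, zpow_add_apply _ _ _⟩

theorem commute_of_generator (hgen : ∀ φ : P ≃o P, ∃ m : ℤ, g ^ m = φ) (φ : P ≃o P) (x : P) :
    φ (g x) = g (φ x) := by
  obtain ⟨m, rfl⟩ := hgen φ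
  rw [← RelIso.mul_apply, ← RelIso.mul_apply, (Commute.refl g).zpow_left m]

variable [Finite P]

theorem zpow_apply_eq_self_iff (x : P) (m : ℤ) :
    (g ^ m) x = x ↔ ((orbit g x).ncard : ℤ) ∣ m := by
  have : Fintype P := Fintype.ofFinite P
  have h : orbit g x = MulAction.orbit (Subgroup.zpowers g) x := by
    ext y
    constructor
    · rintro ⟨k, rfl⟩
      exact ⟨⟨g ^ k, k, rfl⟩, rfl⟩
    · rintro ⟨⟨_, k, rfl⟩, rfl⟩
      exact ⟨k, rfl⟩
  rw [h, ← Nat.card_coe_set_eq, Nat.card_eq_fintype_card, ← MulAction.minimalPeriod_eq_card,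
    ← MulAction.zpow_smul_eq_iff_minimalPeriod_dvd]
  rfl

theorem zpow_apply_eq_zpow_apply_iff (x : P) (i j : ℤ) :
    (g ^ i) x = (g ^ j) x ↔ ((orbit g x).ncard : ℤ) ∣ i - j := by
  rw [← zpow_apply_eq_self_iff, ← (g ^ j).injective.eq_iff (b := x), ← zpow_add_apply,
    add_sub_cancel]

theorem ncard_orbit_ne_zero (x : P) : (orbit g x).ncard ≠ 0 :=
  (Set.ncard_pos (Set.toFinite _)).2 ⟨x, mem_orbit_self g x⟩ |>.ne'

theorem ncard_orbit_dvd_orderOf (x : P) : (orbit g x).ncard ∣ orderOf g := by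
  rw [← Int.natCast_dvd_natCast, ← zpow_apply_eq_self_iff, zpow_natCast, pow_orderOf_eq_one]
  rfl

/-- Orbits of automorphisms of finite posets are antichains. -/
theorem eq_of_le_of_mem_orbit {x y z : P} (hx : x ∈ orbit g z) (hy : y ∈ orbit g z)
    (h : x ≤ y) : x = y := by
  rw [← orbit_eq_of_mem hx] at hy
  obtain ⟨m, rfl⟩ := hy
  have : Finite (P ≃o P) := DFunLike.finite _
  obtain ⟨N, hN, hN1⟩ := (isOfFinOrder_of_finite (g ^ m)).exists_pow_eq_one
  have mono : ∀ j : ℕ, (g ^ m) x ≤ ((g ^ m) ^ (j + 1)) x := by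
    intro j
    induction j with
    | zero => simp
    | succ j ih =>
      refine ih.trans ?_
      rw [pow_succ _ (j + 1), RelIso.mul_apply]
      exact ((g ^ m) ^ (j + 1)).monotone h
  have := mono (N - 1)
  rw [Nat.sub_add_cancel hN, hN1] at this
  exact le_antisymm h this

/-- If `p ∣ |orbit g a|`, the orbit of `a` maps equivariantly to `ℤ/p`. -/
theorem exists_equivariant_zmod {p : ℕ} {a : P} (hp : p ∣ (orbit g a).ncard) :
    ∃ κ : P → ZMod p, ∀ i : ℤ, κ ((g ^ i) a) = (i : ZMod p) := by
  refine ⟨fun x => if h : ∃ i : ℤ, (g ^ i) a = x then ((h.choose : ℤ) : ZMod p) else 0,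
    fun i => ?_⟩
  have h : ∃ k : ℤ, (g ^ k) a = (g ^ i) a := ⟨i, rfl⟩
  beta_reduce
  rw [dif_pos h, ZMod.intCast_eq_intCast_iff_dvd_sub]
  exact (Int.natCast_dvd_natCast.2 hp).trans
    ((zpow_apply_eq_zpow_apply_iff a _ _).1 h.choose_spec.symm)

/-- An invariant relation between an orbit of size `p` and another orbit, of size divisible by
`p`, is determined by a subset of `ℤ/p`. -/
theorem rel_zpow_zpow_iff {p : ℕ} {a b : P} (ha : (orbit g a).ncard = p) (R : P → P → Prop)
    (hR : ∀ (m : ℤ) (x y : P), R x y ↔ R ((g ^ m) x) ((g ^ m) y)) (i j : ℤ) :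
    R ((g ^ i) a) ((g ^ j) b) ↔ ∃ k : ℤ, (k : ZMod p) = (j : ZMod p) - i ∧ R a ((g ^ k) b) := by
  constructor
  · intro h
    refine ⟨j - i, by push_cast; rfl, (hR i _ _).2 ?_⟩
    rwa [← zpow_add_apply, add_sub_cancel]
  · rintro ⟨k, hk, h⟩
    rw [hR (j - k), ← zpow_add_apply, sub_add_cancel] at h
    have : (g ^ (j - k)) a = (g ^ i) a := by
      rw [zpow_apply_eq_zpow_apply_iff, ha, ← ZMod.intCast_zmod_eq_zero_iff_dvd]
      push_cast
      rw [hk]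
      ring
    rwa [this] at h

end Orbits

section Automorphisms

variable {P : Type} [PartialOrder P] [Finite P] {g : P ≃o P} {p r n : ℕ}

/-- The power `g ^ (n / p)` fixes every orbit of size not divisible by `p ^ r ∥ n`. -/
theorem zpow_div_apply_eq_self_iff (hp : p.Prime) (hr : r ≠ 0)
    (hord : orderOf g = n) (hq : ExactDvd (p ^ r) n) (x : P) :
    (g ^ ((n / p : ℕ) : ℤ)) x = x ↔ ¬ p ^ r ∣ (orbit g x).ncard := by
  rw [zpow_apply_eq_self_iff, Int.natCast_dvd_natCast]
  have hl : (orbit g x).ncard ∣ n := hord ▸ ncard_orbit_dvd_orderOf x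
  obtain ⟨hq1, hq2⟩ := (exactDvd_prime_pow hp hr).1 hq
  have hpn : p ∣ n := (dvd_pow_self p hr).trans hq1
  constructor
  · intro h hd
    apply hq2
    rw [pow_succ]
    exact (mul_dvd_mul_right (hd.trans h) p).trans (Nat.div_mul_cancel hpn).dvd
  · intro h
    obtain ⟨k, hk⟩ := hl
    have hpk : p ∣ k := by
      by_contra hpk
      apply h
      rw [hk] at hq1
      exact (((Nat.Prime.coprime_iff_not_dvd hp).2 hpk).pow_left r).dvd_of_dvd_mul_right hq1
    obtain ⟨t, rfl⟩ := hpk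
    refine ⟨t, ?_⟩
    rw [hk, mul_left_comm, Nat.mul_div_cancel_left _ hp.pos]

/-- There are at least two orbits of size divisible by `p ^ r`. -/
theorem exists_two_orbits (hp : p.Prime) (hr : r ≠ 0) (hn : n ≠ 0)
    (hord : orderOf g = n) (hgen : ∀ φ : P ≃o P, ∃ m : ℤ, g ^ m = φ)
    (hq : ExactDvd (p ^ r) n) (h2 : p ^ r ≠ 2) :
    ∃ x y : P, p ^ r ∣ (orbit g x).ncard ∧ p ^ r ∣ (orbit g y).ncard ∧ orbit g x ≠ orbit g y := by
  have hfix := zpow_div_apply_eq_self_iff hp hr hord hq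
  obtain ⟨x, hx⟩ : ∃ x : P, p ^ r ∣ (orbit g x).ncard := by
    by_contra! h
    have h1 : g ^ (n / p) = 1 := by
      ext x
      rw [← zpow_natCast]
      exact (hfix x).2 (h x)
    have hpn : p ∣ n := (dvd_pow_self p hr).trans hq.1
    have hpos : 0 < n / p := Nat.div_pos (Nat.le_of_dvd (Nat.pos_of_ne_zero hn) hpn) hp.pos
    have := Nat.le_of_dvd hpos (hord ▸ orderOf_dvd_of_pow_eq_one h1)
    exact absurd this (Nat.div_lt_self (Nat.pos_of_ne_zero hn) hp.one_lt).not_ge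
  by_contra! hcon
  have hone : ∀ y : P, y ∉ orbit g x → (g ^ ((n / p : ℕ) : ℤ)) y = y := fun y hy =>
    (hfix y).2 fun h => hy (hcon x y hx h ▸ mem_orbit_self g y)
  have hmove : (g ^ ((n / p : ℕ) : ℤ)) x ≠ x := fun h => (hfix x).1 h hx
  have hsmall : ∀ k : ℤ, k ∣ 2 → (g ^ k) x ≠ x := by
    intro k hk h
    have h3 := (Int.natCast_dvd_natCast.2 hx).trans (((zpow_apply_eq_self_iff x k).1 h).trans hk)
    have h4 : p ^ r ∣ 2 := by exact_mod_cast h3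
    have := (Nat.dvd_prime Nat.prime_two).1 h4
    have := Nat.one_lt_pow hr hp.one_lt
    omega
  have hx1 : g x ≠ x := by simpa using hsmall 1 (by norm_num)
  have hx2 : g (g x) ≠ x := by
    have := hsmall 2 (by norm_num)
    rwa [show (2 : ℤ) = 1 + 1 by norm_num, zpow_add_apply, zpow_one] at this
  set h := g ^ ((n / p : ℕ) : ℤ)
  have hxm : x ∈ orbit g x := mem_orbit_self g x
  have hhm : h x ∈ orbit g x := zpow_apply_mem_orbit _ _
  have hle : ∀ y, y ≠ x → y ≠ h x → (y ≤ x ↔ y ≤ h x) ∧ (x ≤ y ↔ h x ≤ y) := by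
    intro y hy1 hy2
    by_cases hy : y ∈ orbit g x
    · exact ⟨iff_of_false (fun hl => hy1 (eq_of_le_of_mem_orbit hy hxm hl))
          (fun hl => hy2 (eq_of_le_of_mem_orbit hy hhm hl)),
        iff_of_false (fun hl => hy1 (eq_of_le_of_mem_orbit hxm hy hl).symm)
          (fun hl => hy2 (eq_of_le_of_mem_orbit hhm hy hl).symm)⟩
    · have := hone y hy
      exact ⟨by rw [← h.le_iff_le (x := y), this], by rw [← h.le_iff_le (y := y), this]⟩
  have hinc : ¬ x ≤ h x := fun hl => hmove (eq_of_le_of_mem_orbit hxm hhm hl).symm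
  have hinc' : ¬ h x ≤ x := fun hl => hmove (eq_of_le_of_mem_orbit hhm hxm hl)
  let σ : P ≃o P := ⟨Equiv.swap x (h x), by
    intro y z
    by_cases hy1 : y = x
    · subst hy1
      by_cases hz1 : z = y
      · subst hz1; simp
      by_cases hz2 : z = h y
      · subst hz2; simp [hinc, hinc']
      rw [Equiv.swap_apply_left, Equiv.swap_apply_of_ne_of_ne hz1 hz2, (hle z hz1 hz2).2]
    by_cases hy2 : y = h x
    · subst hy2
      by_cases hz1 : z = x
      · subst hz1; simp [hinc, hinc']
      by_cases hz2 : z = h x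
      · subst hz2; simp
      rw [Equiv.swap_apply_right, Equiv.swap_apply_of_ne_of_ne hz1 hz2, (hle z hz1 hz2).2]
    rw [Equiv.swap_apply_of_ne_of_ne hy1 hy2]
    by_cases hz1 : z = x
    · subst hz1
      rw [Equiv.swap_apply_left, (hle y hy1 hy2).1]
    by_cases hz2 : z = h x
    · subst hz2
      rw [Equiv.swap_apply_right, (hle y hy1 hy2).1]
    rw [Equiv.swap_apply_of_ne_of_ne hz1 hz2]⟩
  have hσ : ∀ y, σ y = Equiv.swap x (h x) y := fun _ => rfl
  have hcomm := commute_of_generator hgen σ x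
  rw [hσ, hσ, Equiv.swap_apply_left] at hcomm
  by_cases hgx : g x = h x
  · rw [← hgx, Equiv.swap_apply_right] at hcomm
    exact hx2 hcomm.symm
  · rw [Equiv.swap_apply_of_ne_of_ne hx1 hgx] at hcomm
    exact hmove (g.injective hcomm).symm

/-- If exactly two orbits have size divisible by `p = 3, 5, 7`, then neither has size `p`. -/
theorem ncard_orbit_ne_of_two_orbits (hp : p.Prime) (hp357 : p = 3 ∨ p = 5 ∨ p = 7)
    (hord : orderOf g = n) (hgen : ∀ φ : P ≃o P, ∃ m : ℤ, g ^ m = φ)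
    (hq : ExactDvd p n) {a b : P} (hb : p ∣ (orbit g b).ncard)
    (hab : orbit g a ≠ orbit g b)
    (htwo : ∀ y : P, p ∣ (orbit g y).ncard → orbit g y = orbit g a ∨ orbit g y = orbit g b) :
    (orbit g a).ncard ≠ p := by
  intro ha
  have : Fact p.Prime := ⟨hp⟩
  obtain ⟨π, hπ1, hfix⟩ : ∃ π : ℤ, (π : ZMod p) = 1 ∧
      ∀ x, x ∉ orbit g a → x ∉ orbit g b → (g ^ π) x = x := by
    have hnp : ((n / p : ℕ) : ZMod p) ≠ 0 := by
      rw [Ne, ZMod.natCast_eq_zero_iff]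
      rintro ⟨t, ht⟩
      apply hq.2
      rw [hp.minFac_eq]
      exact ⟨t, by rw [mul_assoc, ← ht, Nat.mul_div_cancel' hq.1]⟩
    refine ⟨((n / p : ℕ) : ℤ) * (((n / p : ℕ) : ZMod p)⁻¹.val : ℕ), ?_, fun x hxa hxb => ?_⟩
    · rw [Int.cast_mul, Int.cast_natCast, Int.cast_natCast, ZMod.natCast_zmod_val]
      exact mul_inv_cancel₀ hnp
    · have h1 := (zpow_div_apply_eq_self_iff (r := 1) hp one_ne_zero hord (by simpa using hq)
        x).2 (by
          rw [pow_one]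
          intro h
          rcases htwo x h with h | h
          · exact hxa (h ▸ mem_orbit_self g x)
          · exact hxb (h ▸ mem_orbit_self g x))
      rw [zpow_apply_eq_self_iff] at h1 ⊢
      exact h1.mul_right _
  have hba : ∀ x, x ∈ orbit g b → x ∉ orbit g a := fun x hxb hxa =>
    hab ((orbit_eq_of_mem hxa).symm.trans (orbit_eq_of_mem hxb))
  obtain ⟨κa, hκa⟩ := exists_equivariant_zmod (g := g) (a := a) ha.symm.dvd
  obtain ⟨κb, hκb⟩ := exists_equivariant_zmod hb
  have hle : ∀ i j : ℤ, (g ^ i) a ≤ (g ^ j) b ↔ _ :=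
    rel_zpow_zpow_iff ha (· ≤ ·) fun m x y => ((g ^ m).le_iff_le).symm
  have hge : ∀ i j : ℤ, (g ^ j) b ≤ (g ^ i) a ↔ _ :=
    rel_zpow_zpow_iff ha (fun x y => y ≤ x) fun m x y => ((g ^ m).le_iff_le).symm
  set S : ZMod p → Prop := fun s => ∃ k : ℤ, (k : ZMod p) = s ∧ a ≤ (g ^ k) b
  set T : ZMod p → Prop := fun s => ∃ k : ℤ, (k : ZMod p) = s ∧ (g ^ k) b ≤ a
  obtain ⟨u, c, hu0, hu1, hSu, hTu⟩ : ∃ u c : ZMod p, u ≠ 0 ∧ u ≠ 1 ∧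
      (∀ s, S s ↔ S (u * s + c)) ∧ ∀ s, T s ↔ T (u * s + c) := by
    by_cases hne : ∃ s, S s
    · obtain ⟨u, c, h0, h1, h⟩ := exists_affine_symmetry hp357 S
      have hT0 : ∀ s, ¬ T s := by
        rintro _ ⟨k, -, hk⟩
        obtain ⟨_, j, -, hj⟩ := hne
        have := eq_of_le_of_mem_orbit (zpow_apply_mem_orbit k b) (zpow_apply_mem_orbit j b)
          (hk.trans hj)
        have hak : a = (g ^ k) b := le_antisymm (this ▸ hj) hk
        exact hba _ (hak ▸ zpow_apply_mem_orbit k b) (mem_orbit_self g a)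
      exact ⟨u, c, h0, h1, h, fun s => iff_of_false (hT0 _) (hT0 _)⟩
    · obtain ⟨u, c, h0, h1, h⟩ := exists_affine_symmetry hp357 T
      push Not at hne
      exact ⟨u, c, h0, h1, fun s => iff_of_false (hne _) (hne _), h⟩
  let e : P → ZMod p := fun x =>
    if x ∈ orbit g a then (u - 1) * κa x else if x ∈ orbit g b then (u - 1) * κb x + c else 0
  let φ : P → P := fun x => (g ^ (π * ((e x).val : ℤ))) x
  have hφ : ∀ x, φ x = (g ^ (π * ((e x).val : ℤ))) x := fun _ => rfl
  have hcast : ∀ z : ZMod p, ((π * (z.val : ℤ) : ℤ) : ZMod p) = z := by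
    intro z
    push_cast
    rw [hπ1, one_mul, ZMod.natCast_zmod_val]
  have hea : ∀ i : ℤ, e ((g ^ i) a) = (u - 1) * i := fun i => by
    simp only [e]
    rw [if_pos (zpow_apply_mem_orbit i a), hκa]
  have heb : ∀ j : ℤ, e ((g ^ j) b) = (u - 1) * j + c := fun j => by
    simp only [e]
    rw [if_neg (hba _ (zpow_apply_mem_orbit j b)), if_pos (zpow_apply_mem_orbit j b), hκb]
  have hφa : ∀ i : ℤ, ∃ i' : ℤ, φ ((g ^ i) a) = (g ^ i') a ∧ (i' : ZMod p) = u * i := fun i =>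
    ⟨_, by rw [hφ, ← zpow_add_apply], by rw [Int.cast_add, hcast, hea]; ring⟩
  have hφb : ∀ j : ℤ, ∃ j' : ℤ, φ ((g ^ j) b) = (g ^ j') b ∧ (j' : ZMod p) = u * j + c := fun j =>
    ⟨_, by rw [hφ, ← zpow_add_apply], by rw [Int.cast_add, hcast, heb]; ring⟩
  have hφo : ∀ x, x ∉ orbit g a → x ∉ orbit g b → φ x = x := by
    intro x hxa hxb
    rw [hφ, zpow_mul, zpow_natCast]
    simp [e, hxa, hxb]
  have hma : ∀ x, φ x ∈ orbit g a ↔ x ∈ orbit g a := fun x => zpow_apply_mem_orbit_iff _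
  have hmb : ∀ x, φ x ∈ orbit g b ↔ x ∈ orbit g b := fun x => zpow_apply_mem_orbit_iff _
  have hinj_of_e : ∀ x y, φ x = φ y → e x = e y → x = y := by
    intro x y hxy hexy
    rw [hφ, hφ, hexy] at hxy
    exact (g ^ _).injective hxy
  have hinj : Function.Injective φ := by
    intro x y hxy
    apply hinj_of_e x y hxy
    by_cases hxa : x ∈ orbit g a
    · have hya : y ∈ orbit g a := by rwa [← hma, ← hxy, hma]
      obtain ⟨i, rfl⟩ := hxa
      obtain ⟨j, rfl⟩ := hya
      obtain ⟨i', hi, hi'⟩ := hφa i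
      obtain ⟨j', hj, hj'⟩ := hφa j
      rw [hi, hj] at hxy
      have := congrArg κa hxy
      rw [hκa, hκa, hi', hj'] at this
      rw [hea, hea, mul_left_cancel₀ hu0 this]
    by_cases hxb : x ∈ orbit g b
    · have hyb : y ∈ orbit g b := by rwa [← hmb, ← hxy, hmb]
      obtain ⟨i, rfl⟩ := hxb
      obtain ⟨j, rfl⟩ := hyb
      obtain ⟨i', hi, hi'⟩ := hφb i
      obtain ⟨j', hj, hj'⟩ := hφb j
      rw [hi, hj] at hxy
      have := congrArg κb hxy
      rw [hκb, hκb, hi', hj'] at this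
      rw [heb, heb, mul_left_cancel₀ hu0 (add_right_cancel this)]
    have hya : y ∉ orbit g a := by rwa [← hma, ← hxy, hma]
    have hyb : y ∉ orbit g b := by rwa [← hmb, ← hxy, hmb]
    simp [e, hxa, hxb, hya, hyb]
  have hsame : ∀ x y z, x ∈ orbit g z → y ∈ orbit g z → φ x ∈ orbit g z → φ y ∈ orbit g z →
      (φ x ≤ φ y ↔ x ≤ y) := by
    intro x y z hx hy hx' hy'
    constructor
    · intro h
      exact (hinj (eq_of_le_of_mem_orbit hx' hy' h)).le
    · intro h
      rw [eq_of_le_of_mem_orbit hx hy h]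
  have houtl : ∀ x y, x ∉ orbit g a → x ∉ orbit g b → (φ x ≤ φ y ↔ x ≤ y) := by
    intro x y hxa hxb
    have : (g ^ (π * ((e y).val : ℤ))) x = x := by
      rw [zpow_apply_eq_self_iff]
      exact ((zpow_apply_eq_self_iff x π).1 (hfix x hxa hxb)).mul_right _
    rw [hφo x hxa hxb, hφ y]
    nth_rewrite 1 [← this]
    exact (g ^ _).le_iff_le
  have houtr : ∀ x y, y ∉ orbit g a → y ∉ orbit g b → (φ x ≤ φ y ↔ x ≤ y) := by
    intro x y hya hyb
    have : (g ^ (π * ((e x).val : ℤ))) y = y := by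
      rw [zpow_apply_eq_self_iff]
      exact ((zpow_apply_eq_self_iff y π).1 (hfix y hya hyb)).mul_right _
    rw [hφo y hya hyb, hφ x]
    nth_rewrite 1 [← this]
    exact (g ^ _).le_iff_le
  have hshift : ∀ {i j i' j' : ℤ}, (i' : ZMod p) = u * i → (j' : ZMod p) = u * j + c →
      (j' : ZMod p) - i' = u * (j - i) + c := by
    intro i j i' j' hi hj
    rw [hi, hj]
    ring
  have hiff : ∀ x y, φ x ≤ φ y ↔ x ≤ y := by
    intro x y
    by_cases hxa : x ∈ orbit g a
    · by_cases hya : y ∈ orbit g a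
      · exact hsame x y a hxa hya ((hma x).2 hxa) ((hma y).2 hya)
      by_cases hyb : y ∈ orbit g b
      · obtain ⟨i, rfl⟩ := hxa
        obtain ⟨j, rfl⟩ := hyb
        obtain ⟨i', hi, hi'⟩ := hφa i
        obtain ⟨j', hj, hj'⟩ := hφb j
        rw [hi, hj, hle, hle, hshift hi' hj']
        exact (hSu _).symm
      · exact houtr x y hya hyb
    by_cases hxb : x ∈ orbit g b
    · by_cases hyb : y ∈ orbit g b
      · exact hsame x y b hxb hyb ((hmb x).2 hxb) ((hmb y).2 hyb)
      by_cases hya : y ∈ orbit g a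
      · obtain ⟨j, rfl⟩ := hxb
        obtain ⟨i, rfl⟩ := hya
        obtain ⟨i', hi, hi'⟩ := hφa i
        obtain ⟨j', hj, hj'⟩ := hφb j
        rw [hi, hj, hge, hge, hshift hi' hj']
        exact (hTu _).symm
      · exact houtr x y hya hyb
    exact houtl x y hxa hxb
  let Φ : P ≃o P := ⟨Equiv.ofBijective φ (Finite.injective_iff_bijective.1 hinj), hiff _ _⟩
  have hcomm : φ (g a) = g (φ a) := commute_of_generator hgen Φ a
  obtain ⟨i, hi, hi'⟩ := hφa 0
  obtain ⟨j, hj, hj'⟩ := hφa 1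
  rw [zpow_zero, RelIso.coe_one, id] at hi
  rw [zpow_one] at hj
  rw [hi, hj, show g ((g ^ i) a) = (g ^ (1 + i)) a by rw [zpow_add_apply, zpow_one]] at hcomm
  have := congrArg κa hcomm
  rw [hκa, hκa, Int.cast_add, hi', hj'] at this
  push_cast at this
  apply hu1
  simpa using this

end Automorphisms

/-- (Theorem 4.1, first case.) Let `P` be a finite poset with `Aut(P)` cyclic of order
`n ≥ 1` generated by `g`. If `p^r ∉ {2,4}` is a prime power exactly dividing `n`, then
`Σ_{α ∈ g} w_{p^r}(α) ≥ b(p^r)`. -/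
theorem weight_sum_ge_b (n : ℕ) (hn : 1 ≤ n)
    (P : Type) [PartialOrder P] [Fintype P] (g : P ≃o P)
    (hord : orderOf g = n) (hgen : ∀ φ : P ≃o P, ∃ m : ℤ, g ^ m = φ)
    (p r : ℕ) (hp : p.Prime) (hr : 1 ≤ r) (hq : ExactDvd (p ^ r) n)
    (h2 : p ^ r ≠ 2) (h4 : p ^ r ≠ 4) :
    (b (p ^ r) : ℚ) ≤ ∑ᶠ A ∈ cycles g, w n A.ncard (p ^ r) := by
  have hr0 : r ≠ 0 := by omega
  have hn0 : n ≠ 0 := by omega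
  have hq1 : 1 < p ^ r := Nat.one_lt_pow hr0 hp.one_lt
  have hfin : (cycles g).Finite := Set.toFinite _
  rw [finsum_mem_eq_finite_toFinset_sum _ hfin]
  have hcyc : ∀ x : P, p ^ r ∣ (orbit g x).ncard → orbit g x ∈ hfin.toFinset := fun x hx =>
    hfin.mem_toFinset.2 ⟨⟨x, rfl⟩,
      hq1.trans_le (Nat.le_of_dvd (Nat.pos_of_ne_zero (ncard_orbit_ne_zero x)) hx)⟩
  have hw : ∀ x : P, p ^ r ∣ (orbit g x).ncard → 1 ≤ w n (orbit g x).ncard (p ^ r) := fun x hx =>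
    one_le_w hp hr0 h2 h4 hq (ncard_orbit_ne_zero x) (hord ▸ ncard_orbit_dvd_orderOf x) hx
  have hsub : ∀ s : Finset (Set P), s ⊆ hfin.toFinset →
      ∑ A ∈ s, w n A.ncard (p ^ r) ≤ ∑ A ∈ hfin.toFinset, w n A.ncard (p ^ r) := fun s hs =>
    Finset.sum_le_sum_of_subset_of_nonneg hs fun A _ _ => w_nonneg _ _ _
  obtain ⟨x, y, hx, hy, hxy⟩ := exists_two_orbits hp hr0 hn0 hord hgen hq h2
  have hpair := hsub {orbit g x, orbit g y} (Finset.insert_subset (hcyc x hx)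
    (Finset.singleton_subset_iff.2 (hcyc y hy)))
  rw [Finset.sum_pair hxy] at hpair
  by_cases h357 : p ^ r = 3 ∨ p ^ r = 5 ∨ p ^ r = 7
  · have hb : b (p ^ r) = 3 := by
      rcases h357 with h | h | h <;> rw [h] <;> rfl
    rw [hb]
    by_cases h3 : ∀ z : P, p ^ r ∣ (orbit g z).ncard → orbit g z = orbit g x ∨ orbit g z = orbit g y
    · have hprime : (p ^ r).Prime := by
        rcases h357 with h | h | h <;> rw [h] <;> norm_num
      have hx' := ncard_orbit_ne_of_two_orbits hprime h357 hord hgen hq hy hxy h3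
      have hy' := ncard_orbit_ne_of_two_orbits hprime h357 hord hgen hq hx hxy.symm
        fun z hz => (h3 z hz).symm
      have hw' : ∀ z : P, p ^ r ∣ (orbit g z).ncard → (orbit g z).ncard ≠ p ^ r →
          3 / 2 ≤ w n (orbit g z).ncard (p ^ r) := fun z hz hz' =>
        three_halves_le_w hp hr0 h357 hq (ncard_orbit_ne_zero z)
          (hord ▸ ncard_orbit_dvd_orderOf z) hz hz'
      push_cast
      linarith [hw' x hx hx', hw' y hy hy']
    · push Not at h3
      obtain ⟨z, hz, hzx, hzy⟩ := h3
      have htriple := hsub {orbit g z, orbit g x, orbit g y} (Finset.insert_subset (hcyc z hz)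
        (Finset.insert_subset (hcyc x hx) (Finset.singleton_subset_iff.2 (hcyc y hy))))
      rw [Finset.sum_insert (by simp [hzx, hzy]), Finset.sum_pair hxy] at htriple
      push_cast
      linarith [hw x hx, hw y hy, hw z hz]
  · have hb : b (p ^ r) = 2 := by
      push Not at h357
      simp [b, hq1.ne', h2, h4, h357, -pow_eq_one_iff]
    rw [hb]
    push_cast
    linarith [hw x hx, hw y hy]
end
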